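/- (Non-expansiveness, half of Proposition 3) Let S₁ = (f₁, ψ) and S₂ = (f₂, ψ) be two signals sharing the same reliability function ψ, let P = (h, χ) be a pattern over D, and suppose C ≥ 0 satisfies |f₁(q) − f₂(q)| ≤ C for all q ∈ ℝ². Then |ĉ_{S₁,P}(x,y) − ĉ_{S₂,P}(x,y)| ≤ C for every (x,y) ∈ ℝ²; in particular the operator F taking f to ĉ_{(f,ψ),P} is non-expansive with respect to the supremum norm. -/

import Mathlib

open MeasureTheory Set

noncomputable section

/-- The plane ℝ². -/
abbrev Plane := EuclideanSpace ℝ (Fin 2)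

/-- The normalized measure μ(A) = λ̄(A) / λ̄(D). -/
def mu (D : Set Plane) : Measure Plane := (volume D)⁻¹ • volume

/-- The indicator function χ of the set D. -/
def chi (D : Set Plane) : Plane → ℝ := D.indicator (fun _ => (1 : ℝ))

/-- The reliability integral 𝒜_{S,P}(p) = ∫ ψ(p+q) χ(q) dμ(q). -/
def Acal (D : Set Plane) (ψ : Plane → ℝ) (p : Plane) : ℝ :=
  ∫ q, ψ (p + q) * chi D q ∂(mu D)

/-- The comparison integral 𝒮_{S,P}(p) = ∫ |f(p+q) − h(q)| ψ(p+q) χ(q) dμ(q). -/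
def Scal (D : Set Plane) (f ψ h : Plane → ℝ) (p : Plane) : ℝ :=
  ∫ q, |f (p + q) - h q| * ψ (p + q) * chi D q ∂(mu D)

/-- The similarity coefficient ĉ_{S,P} = 𝒜_{S,P} − 𝒮_{S,P}. -/
def chat (D : Set Plane) (f ψ h : Plane → ℝ) (p : Plane) : ℝ :=
  Acal D ψ p - Scal D f ψ h p

/-- The indicator of `D` is integrable for the normalized measure. -/
lemma integrable_chi {D : Set Plane} (hD : MeasurableSet D)
    (hD0 : 0 < volume D) (hDfin : volume D < ⊤) : Integrable (chi D) (mu D) := by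
  have h : Integrable (chi D) volume :=
    (integrable_indicator_iff hD).2 (integrableOn_const hDfin.ne)
  exact h.smul_measure (ENNReal.inv_ne_top.2 hD0.ne')

/-- The indicator of `D` integrates to one for the normalized measure. -/
lemma integral_chi {D : Set Plane} (hD : MeasurableSet D)
    (hD0 : 0 < volume D) (hDfin : volume D < ⊤) : ∫ q, chi D q ∂(mu D) = 1 := by
  have h : (volume D).toReal ≠ 0 := (ENNReal.toReal_pos hD0.ne' hDfin.ne).ne'
  simp [mu, chi, integral_indicator_const _ hD, Measure.real, h]

lemma chi_nonneg (D : Set Plane) (q : Plane) : 0 ≤ chi D q :=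
  indicator_nonneg (fun _ _ => zero_le_one) q

/-- The integrand of the comparison integral is integrable. -/
lemma integrable_comparison {D : Set Plane} (hD : MeasurableSet D)
    (hD0 : 0 < volume D) (hDfin : volume D < ⊤) {f ψ h : Plane → ℝ}
    (hf : Measurable f) (hψ : Measurable ψ) (hh : Measurable h)
    (hf01 : ∀ q, f q ∈ Icc (0 : ℝ) 1) (hψ01 : ∀ q, ψ q ∈ Icc (0 : ℝ) 1)
    (hh01 : ∀ q, h q ∈ Icc (0 : ℝ) 1) (p : Plane) :
    Integrable (fun q => |f (p + q) - h q| * ψ (p + q) * chi D q) (mu D) := by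
  have hadd : Measurable fun q : Plane => p + q := measurable_const_add p
  have hm : Measurable fun q => |f (p + q) - h q| * ψ (p + q) := by
    have h₁ : Measurable fun q => f (p + q) - h q := (hf.comp hadd).sub hh
    exact (continuous_abs.measurable.comp h₁).mul (hψ.comp hadd)
  refine (integrable_chi hD hD0 hDfin).bdd_mul (c := 1) hm.aestronglyMeasurable
    (Filter.Eventually.of_forall fun q => ?_)
  obtain ⟨hψ0, hψ1⟩ := hψ01 (p + q)
  obtain ⟨hf0, hf1⟩ := hf01 (p + q)
  obtain ⟨hh0, hh1⟩ := hh01 q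
  rw [Real.norm_of_nonneg (mul_nonneg (abs_nonneg _) hψ0)]
  exact mul_le_one₀ (abs_le.2 ⟨by linarith, by linarith⟩) hψ0 hψ1

/-- non-expansiveness: |ĉ_{S₁,P}(p) − ĉ_{S₂,P}(p)| ≤ C whenever
|f₁ − f₂| ≤ C uniformly (same reliability function ψ). -/
theorem stmt_8 (D : Set Plane) (hD : MeasurableSet D)
    (hD0 : 0 < volume D) (hDfin : volume D < ⊤)
    (f₁ f₂ ψ h : Plane → ℝ)
    (hf₁ : Measurable f₁) (hf₂ : Measurable f₂) (hψ : Measurable ψ) (hh : Measurable h)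
    (hf₁01 : ∀ q, f₁ q ∈ Icc (0 : ℝ) 1) (hf₂01 : ∀ q, f₂ q ∈ Icc (0 : ℝ) 1)
    (hψ01 : ∀ q, ψ q ∈ Icc (0 : ℝ) 1) (hh01 : ∀ q, h q ∈ Icc (0 : ℝ) 1)
    (C : ℝ) (hC : 0 ≤ C) (hbound : ∀ q, |f₁ q - f₂ q| ≤ C) :
    ∀ p : Plane, |chat D f₁ ψ h p - chat D f₂ ψ h p| ≤ C := by
  intro p
  have h₁ := integrable_comparison hD hD0 hDfin hf₁ hψ hh hf₁01 hψ01 hh01 p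
  have h₂ := integrable_comparison hD hD0 hDfin hf₂ hψ hh hf₂01 hψ01 hh01 p
  have hdiff : chat D f₁ ψ h p - chat D f₂ ψ h p =
      ∫ q, (|f₂ (p + q) - h q| * ψ (p + q) * chi D q
        - |f₁ (p + q) - h q| * ψ (p + q) * chi D q) ∂(mu D) := by
    rw [integral_sub h₂ h₁, chat, chat, Scal, Scal]
    ring
  rw [hdiff, ← Real.norm_eq_abs]
  calc _ ≤ ∫ q, C * chi D q ∂(mu D) := by
        refine norm_integral_le_of_norm_le ((integrable_chi hD hD0 hDfin).const_mul C)
          (Filter.Eventually.of_forall fun q => ?_)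
        obtain ⟨hψ0, hψ1⟩ := hψ01 (p + q)
        have hle : |(|f₂ (p + q) - h q| - |f₁ (p + q) - h q|)| ≤ C := by
          refine (abs_abs_sub_abs_le_abs_sub _ _).trans ?_
          rw [sub_sub_sub_cancel_right, abs_sub_comm]
          exact hbound _
        rw [← sub_mul, ← sub_mul, Real.norm_eq_abs, abs_mul, abs_mul,
          abs_of_nonneg hψ0, abs_of_nonneg (chi_nonneg D q)]
        exact mul_le_mul_of_nonneg_right
          ((mul_le_of_le_one_right (abs_nonneg _) hψ1).trans hle) (chi_nonneg D q)
    _ = C := by rw [integral_const_mul, integral_chi hD hD0 hDfin, mul_one]
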